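/- Let Γ be a finite simplicial graph with vertex set V such that Z = {v ∈ V : st(v) = V} is non-empty, and let A = A(Γ). Let Q be a p-set with admissible partition {Q₁, Q₂}, where Q₁ = {π_{a₁,K₁}, …, π_{a_m,K_m}} and Q₂ = {π_{b₁,L₁}, …, π_{b_n,L_n}}. Let G₁ be the free abelian group with basis {u₁, …, u_m}, let G₂ be the free abelian group with basis {v₁, …, v_n}, and let G = G₁ ∗ G₂ be their free product. Then there is a (necessarily surjective) group homomorphism φ : PΣ(A) → G with φ(π_{a_i,K_i}) = u_i for i = 1, …, m, φ(π_{b_j,L_j}) = v_j for j = 1, …, n, and φ(π_{c,M}) = 1 for every other partial conjugation π_{c,M}. -/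

import Mathlib

open SimpleGraph

/-- The star of a vertex: the vertex together with its neighbours. -/
def Gstar {V : Type} (Γ : SimpleGraph V) (a : V) : Set V := insert a (Γ.neighborSet a)

/-- The set of vertices whose star is the whole vertex set. -/
def Zset {V : Type} (Γ : SimpleGraph V) : Set V := {v | Gstar Γ v = Set.univ}

/-- `K` is (the vertex set of) a connected component of the full subgraph of `Γ`
induced on the vertex set `S`. -/
def IsCompOf {V : Type} (Γ : SimpleGraph V) (S K : Set V) : Prop :=
  ∃ c : (Γ.induce S).ConnectedComponent, K = Subtype.val '' c.supp

/-- The defining relators of the right-angled Artin group of `Γ`. -/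
def raagRels {V : Type} (Γ : SimpleGraph V) : Set (FreeGroup V) :=
  {r | ∃ a b : V, Γ.Adj a b ∧
    r = FreeGroup.of a * FreeGroup.of b * (FreeGroup.of a)⁻¹ * (FreeGroup.of b)⁻¹}

/-- The right-angled Artin group `A(Γ)`. -/
abbrev RAAG {V : Type} (Γ : SimpleGraph V) : Type := PresentedGroup (raagRels Γ)

/-- The generator of `A(Γ)` corresponding to a vertex `v`. -/
def raagGen {V : Type} (Γ : SimpleGraph V) (v : V) : RAAG Γ := PresentedGroup.of v

/-- The pure symmetric automorphism group: automorphisms sending each standard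
generator to a conjugate of itself. -/
def PSA {V : Type} (Γ : SimpleGraph V) : Subgroup (MulAut (RAAG Γ)) where
  carrier := {φ | ∀ v : V, IsConj (raagGen Γ v) (φ (raagGen Γ v))}
  one_mem' := fun v => IsConj.refl _
  mul_mem' := by
    intro φ ψ hφ hψ v
    have h2 : IsConj (φ (raagGen Γ v)) (φ (ψ (raagGen Γ v))) :=
      φ.toMonoidHom.map_isConj (hψ v)
    simpa [MulAut.mul_apply] using (hφ v).trans h2
  inv_mem' := by
    intro φ hφ v
    have h := (φ⁻¹ : MulAut (RAAG _)).toMonoidHom.map_isConj (hφ v)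
    simp only [MulEquiv.toMonoidHom_eq_coe, MonoidHom.coe_coe, MulAut.inv_def,
      MulEquiv.symm_apply_apply] at h
    exact h.symm

/-- `φ` is the partial conjugation `π_{a,K}`. -/
def IsPartialConj {V : Type} (Γ : SimpleGraph V) (a : V) (K : Set V)
    (φ : MulAut (RAAG Γ)) : Prop :=
  IsCompOf Γ (Gstar Γ a)ᶜ K ∧
  (∀ v ∈ K, φ (raagGen Γ v) = (raagGen Γ a)⁻¹ * raagGen Γ v * raagGen Γ a) ∧
  (∀ v ∉ K, φ (raagGen Γ v) = raagGen Γ v)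

/-- Combinatorial data (acting letter, domain) of the partial conjugations. -/
def PCSet {V : Type} (Γ : SimpleGraph V) : Set (V × Set V) :=
  {p | IsCompOf Γ (Gstar Γ p.1)ᶜ p.2}

/-- A non-trivial admissible partition (for p-sets). -/
def IsAdmissiblePartition {V : Type} (Q₁ Q₂ : Set (V × Set V)) : Prop :=
  Disjoint Q₁ Q₂ ∧ Q₁.Nonempty ∧ Q₂.Nonempty ∧
    ∀ p ∈ Q₁, ∀ q ∈ Q₂, p.1 ∈ q.2 ∧ q.1 ∈ p.2

/-- A p-set of partial conjugations. -/
def IsPSet {V : Type} (Γ : SimpleGraph V) (Q : Set (V × Set V)) : Prop :=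
  Q ⊆ PCSet Γ ∧
  (∀ a : V, {p ∈ Q | p.1 = a}.Subsingleton) ∧
  ∃ Q₁ Q₂ : Set (V × Set V), Q₁ ∪ Q₂ = Q ∧ IsAdmissiblePartition Q₁ Q₂

/-- A non-trivial admissible partition (for δ-p-sets). -/
def IsDeltaAdmissiblePartition {V : Type} (Q₁ Q₂ : Set (V × Set V)) : Prop :=
  Disjoint Q₁ Q₂ ∧ Q₁.Nonempty ∧ Q₂.Nonempty ∧
    ∀ p ∈ Q₁, ∀ q ∈ Q₂, p.1 ∈ q.2 ∨ q.1 ∈ p.2 ∨ p.2 = q.2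

/-- A δ-p-set of partial conjugations. -/
def IsDeltaPSet {V : Type} (Γ : SimpleGraph V) (Q : Set (V × Set V)) : Prop :=
  Q ⊆ PCSet Γ ∧
  (∀ a : V, a ∉ Zset Γ →
    ({p ∈ Q | p.1 = a}.ncard = 0 ∨ {p ∈ Q | p.1 = a}.ncard = 2)) ∧
  ∃ Q₁ Q₂ : Set (V × Set V), Q₁ ∪ Q₂ = Q ∧ IsDeltaAdmissiblePartition Q₁ Q₂

/-- `Γ` has a separating intersection of links. -/
def HasSIL {V : Type} (Γ : SimpleGraph V) : Prop :=
  ∃ a b : V, a ≠ b ∧ ¬Γ.Adj a b ∧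
    ∃ M : Set V, IsCompOf Γ (Γ.neighborSet a ∩ Γ.neighborSet b)ᶜ M ∧ a ∉ M ∧ b ∉ M

/-- The full subgraph spanned by `U` is dominating. -/
def Dominating {V : Type} (Γ : SimpleGraph V) (U : Set V) : Prop :=
  ∀ v : V, v ∈ U ∨ ∃ u ∈ U, Γ.Adj v u

/-- The full subgraph spanned by `U` is disconnected or non-dominating. -/
def Missing {V : Type} (Γ : SimpleGraph V) (U : Set V) : Prop :=
  ¬(Γ.induce U).Connected ∨ ¬Dominating Γ U

section HNN

open HNNExtension HNNExtension.NormalWord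

variable {G : Type*} [Group G] {N : Subgroup G}

/-- An element of the base group that is not conjugate into the edge group fixes only the base
vertex of the Bass-Serre tree. -/
theorem HNNExtension.mem_range_of_conj_mem_range {d : G} (hd : ∀ g : G, g⁻¹ * d * g ∉ N)
    {z : HNNExtension G N N (MulEquiv.refl N)}
    (hz : z⁻¹ * of d * z ∈ (of.range : Subgroup (HNNExtension G N N (MulEquiv.refl N)))) :
    z ∈ (of.range : Subgroup (HNNExtension G N N (MulEquiv.refl N))) := by
  obtain ⟨a, ha⟩ := hz
  obtain ⟨D⟩ := TransversalPair.nonempty G N N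
  obtain ⟨w, rfl⟩ : ∃ w : ReducedWord G N N, w.prod (MulEquiv.refl N) = z :=
    ⟨(z • (NormalWord.empty : NormalWord D)).toReducedWord, by
      simp⟩
  obtain ⟨h, l, hl⟩ := w
  rcases List.eq_nil_or_concat l with rfl | ⟨l₀, ⟨u, g⟩, rfl⟩
  · exact ⟨h, by simp [ReducedWord.prod]⟩
  exfalso
  rw [List.concat_eq_append] at *
  have hl' : (l₀ ++ [(u, g * a)]).IsChain
      (fun a b => a.2 ∈ toSubgroup N N a.1 → a.1 = b.1) := by
    rw [List.isChain_append] at hl ⊢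
    simpa using hl
  have hprod : (⟨d * h, l₀ ++ [(u, g)], hl⟩ : ReducedWord G N N).prod (MulEquiv.refl N) =
      (⟨h, l₀ ++ [(u, g * a)], hl'⟩ : ReducedWord G N N).prod (MulEquiv.refl N) := by
    rw [eq_comm, mul_assoc, inv_mul_eq_iff_eq_mul] at ha
    simpa [ReducedWord.prod, mul_assoc] using ha
  have key := (ReducedWord.map_fst_eq_and_of_prod_eq _ hprod).2
  obtain ⟨p, hp⟩ : ∃ p, (l₀ ++ [(u, g)]).head? = some p :=
    Option.isSome_iff_exists.1 (by simp)
  have := key p.1 (by simp [hp])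
  simp only [toSubgroup, ite_self] at this
  refine hd h (by simpa [mul_assoc] using inv_mem this)

theorem HNNExtension.mem_range_of_commute_conj {d d' : G} (hd : ∀ g : G, g⁻¹ * d * g ∉ N)
    (hd' : ∀ g : G, g⁻¹ * d' * g ∉ N) {z : HNNExtension G N N (MulEquiv.refl N)}
    (hz : Commute (z⁻¹ * of d * z) (of d')) :
    z ∈ (of.range : Subgroup (HNNExtension G N N (MulEquiv.refl N))) := by
  refine mem_range_of_conj_mem_range hd (mem_range_of_conj_mem_range hd' ?_)
  rw [mul_assoc, hz.symm.eq, inv_mul_cancel_left]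
  exact ⟨d', rfl⟩

end HNN

section CoprodI

open Monoid Monoid.CoprodI

variable {ι : Type*} {M : ι → Type*} [∀ i, Group (M i)]

theorem Monoid.CoprodI.NeWord.toList_eq_of_prod_eq {i j k l : ι} {w : NeWord M i j}
    {w' : NeWord M k l} (h : w.prod = w'.prod) : w.toList = w'.toList := by
  classical
  exact congrArg Word.toList (Word.equiv.symm.injective h : w.toWord = w'.toWord)

theorem Monoid.CoprodI.NeWord.head_index_eq_of_prod_eq {i j k l : ι} {w : NeWord M i j}
    {w' : NeWord M k l} (h : w.prod = w'.prod) : i = k := by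
  have := congrArg List.head? (NeWord.toList_eq_of_prod_eq h)
  simp only [NeWord.toList_head?, Option.some.injEq] at this
  exact congrArg Sigma.fst this

theorem Monoid.CoprodI.exists_neWord_prod_eq {z : CoprodI M} (hz : z ≠ 1) :
    ∃ (i j : ι) (w : NeWord M i j), w.prod = z := by
  classical
  obtain ⟨i, j, w, hw⟩ := NeWord.of_word (Word.equiv z) (by
    intro h
    apply hz
    rw [← Word.equiv.symm_apply_apply z, h]
    rfl)
  exact ⟨i, j, w, by rw [NeWord.prod, hw]; exact Word.equiv.symm_apply_apply z⟩

theorem Monoid.CoprodI.NeWord.exists_strip_last {i j : ι} (w : NeWord M i j) (l : ι) :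
    (i = l ∧ ∃ q : M l, w.prod = of q) ∨
      ∃ (j' : ι) (w' : NeWord M i j') (q : M l), j' ≠ l ∧ w.prod = w'.prod * of q := by
  induction w with
  | @singleton i x hx =>
    by_cases h : i = l
    · subst h
      exact .inl ⟨rfl, x, by simp⟩
    · exact .inr ⟨i, .singleton x hx, 1, h, by simp⟩
  | @append i j k _ w₁ hne w₂ _ ih =>
    rcases ih with ⟨rfl, q, hq⟩ | ⟨j', w', q, hj', hq⟩
    · exact .inr ⟨j, w₁, q, hne, by simp [hq]⟩
    · exact .inr ⟨j', .append w₁ hne w', q, hj', by simp [hq, mul_assoc]⟩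

/-- Representatives of double cosets of two factors of a free product. -/
theorem Monoid.CoprodI.exists_doubleCoset_decomposition (k l : ι) (z : CoprodI M) :
    ∃ (p : M k) (ω : CoprodI M) (q : M l), z = of p * ω * of q ∧
      (ω = 1 ∨ ∃ (i j : ι) (w : NeWord M i j), i ≠ k ∧ j ≠ l ∧ w.prod = ω) := by
  by_cases hz : z = 1
  · exact ⟨1, 1, 1, by simp [hz], .inl rfl⟩
  obtain ⟨i, j, w, rfl⟩ := exists_neWord_prod_eq hz
  rcases w.exists_strip_last l with ⟨-, q, hq⟩ | ⟨j', w', q, hj', hq⟩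
  · exact ⟨1, 1, q, by simp [hq], .inl rfl⟩
  rcases w'.inv.exists_strip_last k with ⟨-, p, hp⟩ | ⟨i', w'', p, hi', hp⟩
  · refine ⟨p⁻¹, 1, q, ?_, .inl rfl⟩
    rw [NeWord.inv_prod, inv_eq_iff_eq_inv] at hp
    simp [hq, hp]
  · refine ⟨p⁻¹, w''.inv.prod, q, ?_, .inr ⟨i', j', w''.inv, hi', hj', rfl⟩⟩
    rw [NeWord.inv_prod, inv_eq_iff_eq_inv] at hp
    simp [hq, hp]

theorem Monoid.CoprodI.mem_range_of_commute {k : ι} {x : M k} (hx : x ≠ 1) {z : CoprodI M}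
    (hz : Commute z (of x)) : ∃ y : M k, z = of y := by
  obtain ⟨p, ω, q, rfl, rfl | ⟨i, j, w, hi, hj, rfl⟩⟩ := exists_doubleCoset_decomposition k k z
  · exact ⟨p * q, by simp⟩
  exfalso
  have h : w.prod * of (q * x * q⁻¹) = of (p⁻¹ * x * p) * w.prod := by
    have := hz.eq
    simp only [map_mul, map_inv]
    calc w.prod * (of q * of x * (of q)⁻¹)
        = (of p)⁻¹ * (of p * w.prod * of q * of x) * (of q)⁻¹ := by group
      _ = _ := by rw [this]; group
  have h₁ : q * x * q⁻¹ ≠ 1 := by simpa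
  have h₂ : p⁻¹ * x * p ≠ 1 := by
    intro h
    apply hx
    rwa [mul_assoc, inv_mul_eq_one, eq_comm, mul_eq_right] at h
  have h' : (w.append hj (.singleton _ h₁)).prod =
      ((NeWord.singleton _ h₂).append hi.symm w).prod := by
    simpa using h
  exact hi (NeWord.head_index_eq_of_prod_eq h')

theorem Monoid.CoprodI.eq_one_of_forall_commute {k l : ι} (hkl : k ≠ l) [Nontrivial (M k)]
    [Nontrivial (M l)] {z : CoprodI M} (hz : ∀ x, Commute z x) : z = 1 := by
  classical
  obtain ⟨x, hx⟩ := exists_ne (1 : M k)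
  obtain ⟨x', hx'⟩ := exists_ne (1 : M l)
  obtain ⟨y, rfl⟩ := mem_range_of_commute hx (hz (of x))
  obtain ⟨y', h⟩ := mem_range_of_commute hx' (hz (of x'))
  by_cases hy : y = 1
  · simp [hy]
  by_cases hy' : y' = 1
  · simpa [hy'] using h
  exact absurd (NeWord.head_index_eq_of_prod_eq
    (w := .singleton y hy) (w' := .singleton y' hy') (by simpa using h)) hkl

/-- The endomorphism that conjugates the factor `false` by a reduced word that starts in `false`
and ends in `true`, and fixes the factor `true`, is not surjective. -/
theorem Monoid.CoprodI.not_surjective_of_conj {M : Bool → Type*} [∀ i, Group (M i)]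
    [Nontrivial (M false)] (w : NeWord M false true) (F : CoprodI M →* CoprodI M)
    (hFt : ∀ x : M true, F (of x) = of x)
    (hFf : ∀ x : M false, F (of x) = w.prod * of x * w.prod⁻¹) : ¬ Function.Surjective F := by
  have image : ∀ {i j} (n : NeWord M i j), ∃ n' : NeWord M i j, n'.prod = F n.prod ∧
      (i = false → 2 ≤ n'.toList.length) := by
    intro i j n
    induction n with
    | @singleton i x hx =>
      cases i with
      | true => exact ⟨.singleton x hx, by simp [hFt]⟩
      | false =>
        refine ⟨((w.append (by simp) (.singleton x hx)).append (by simp) w.inv),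
          by simp [hFf], fun _ => ?_⟩
        have := List.length_pos_of_ne_nil w.toList_ne_nil
        simp only [NeWord.toList, List.length_append, List.length_singleton]
        omega
    | append w₁ hne w₂ ih₁ ih₂ =>
      obtain ⟨n₁, h₁, h₁'⟩ := ih₁
      obtain ⟨n₂, h₂, -⟩ := ih₂
      refine ⟨n₁.append hne n₂, by simp [h₁, h₂], fun h => ?_⟩
      have := h₁' h
      simp only [NeWord.toList, List.length_append]
      omega
  intro hF
  obtain ⟨x, hx⟩ := exists_ne (1 : M false)
  obtain ⟨z, hz⟩ := hF (of x)
  have hz1 : z ≠ 1 := by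
    rintro rfl
    rw [map_one] at hz
    exact hx (of_injective false (hz.symm.trans (map_one _).symm))
  obtain ⟨i, j, n, rfl⟩ := exists_neWord_prod_eq hz1
  obtain ⟨n', hn', hlen⟩ := image n
  have h : n'.prod = (NeWord.singleton x hx).prod := by simpa [hn'] using hz
  have h2 := hlen (NeWord.head_index_eq_of_prod_eq h)
  rw [NeWord.toList_eq_of_prod_eq h] at h2
  simp at h2

end CoprodI

section RAAG

open Monoid.CoprodI

variable {V : Type} {Γ : SimpleGraph V}

theorem raagGen_commute {a b : V} (h : Γ.Adj a b) : Commute (raagGen Γ a) (raagGen Γ b) := by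
  have : (PresentedGroup.mk (raagRels Γ)) (FreeGroup.of a * FreeGroup.of b * (FreeGroup.of a)⁻¹ *
      (FreeGroup.of b)⁻¹) = 1 := PresentedGroup.one_of_mem ⟨a, b, h, rfl⟩
  simp only [map_mul, map_inv] at this
  exact (mul_inv_eq_iff_eq_mul.1 (mul_inv_eq_one.1 this))

/-- A homomorphism out of a right-angled Artin group. -/
def raagLift {H : Type*} [Group H] (f : V → H) (hf : ∀ a b, Γ.Adj a b → Commute (f a) (f b)) :
    RAAG Γ →* H :=
  PresentedGroup.toGroup (f := f) (by
    rintro r ⟨a, b, hab, rfl⟩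
    simp [(hf a b hab).eq])

@[simp]
theorem raagLift_raagGen {H : Type*} [Group H] (f : V → H)
    (hf : ∀ a b, Γ.Adj a b → Commute (f a) (f b)) (v : V) :
    raagLift f hf (raagGen Γ v) = f v :=
  PresentedGroup.toGroup.of _

theorem raag_hom_ext {H : Type*} [Group H] {f g : RAAG Γ →* H}
    (h : ∀ v, f (raagGen Γ v) = g (raagGen Γ v)) : f = g :=
  PresentedGroup.ext h

theorem closure_range_raagGen : Subgroup.closure (Set.range (raagGen Γ)) = ⊤ :=
  PresentedGroup.closure_range_of _

open scoped Classical in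
/-- The endomorphism of `A(Γ)` killing the vertices in `B` and fixing the others. -/
noncomputable def raagKill (Γ : SimpleGraph V) (B : Set V) : RAAG Γ →* RAAG Γ :=
  raagLift (fun v => if v ∈ B then 1 else raagGen Γ v) (by
    intro a b hab
    split_ifs <;> simp [raagGen_commute hab])

open scoped Classical in
@[simp]
theorem raagKill_raagGen (B : Set V) (v : V) :
    raagKill Γ B (raagGen Γ v) = if v ∈ B then 1 else raagGen Γ v :=
  raagLift_raagGen _ _ _

theorem raagKill_comp_raagKill (B C : Set V) :
    (raagKill Γ B).comp (raagKill Γ C) = raagKill Γ (B ∪ C) := by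
  refine raag_hom_ext fun v => ?_
  by_cases hB : v ∈ B <;> by_cases hC : v ∈ C <;> simp [hB, hC]

theorem raagKill_eq_self_of_forall_mem {B : Set V} (hB : B.Finite) {x : RAAG Γ}
    (hx : ∀ b ∈ B, raagKill Γ {b} x = x) : raagKill Γ B x = x := by
  induction B, hB using Set.Finite.induction_on with
  | empty =>
    have : raagKill Γ (∅ : Set V) = MonoidHom.id _ := raag_hom_ext fun v => by simp
    simp [this]
  | @insert b B _ _ ih =>
    rw [Set.insert_eq, ← raagKill_comp_raagKill, MonoidHom.comp_apply,
      ih fun c hc => hx c (Set.mem_insert_of_mem _ hc), hx b (Set.mem_insert _ _)]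

/-- The subgroup of `A(Γ)` generated by a set of vertices. -/
def raagSpan (Γ : SimpleGraph V) (S : Set V) : Subgroup (RAAG Γ) :=
  Subgroup.closure (raagGen Γ '' S)

open scoped Classical in
theorem conj_raagGen_notMem_raagSpan {S : Set V} {d : V} (hd : d ∉ S) (g : RAAG Γ) :
    g⁻¹ * raagGen Γ d * g ∉ raagSpan Γ S := by
  let χ : RAAG Γ →* Multiplicative ℤ :=
    raagLift (fun v => if v = d then Multiplicative.ofAdd 1 else 1) fun _ _ _ => Commute.all _ _
  have hS : raagSpan Γ S ≤ χ.ker := by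
    rw [raagSpan, Subgroup.closure_le]
    rintro _ ⟨v, hv, rfl⟩
    have : v ≠ d := fun h => hd (h ▸ hv)
    simp [χ, this]
  intro h
  have := hS h
  rw [MonoidHom.mem_ker, map_mul, map_mul, map_inv, mul_comm, mul_inv_cancel_left] at this
  simp only [χ, raagLift_raagGen, if_true] at this
  exact absurd (Multiplicative.ofAdd.injective (this.trans ofAdd_zero.symm)) one_ne_zero

theorem commute_of_mem_raagSpan {S : Set V} {H : Type*} [Group H] {f : RAAG Γ →* H} {y : H}
    (h : ∀ v ∈ S, Commute y (f (raagGen Γ v))) {x : RAAG Γ} (hx : x ∈ raagSpan Γ S) :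
    Commute y (f x) := by
  induction hx using Subgroup.closure_induction with
  | mem x hx => obtain ⟨v, hv, rfl⟩ := hx; exact h v hv
  | one => simp
  | mul x x' _ _ hx hx' => rw [map_mul]; exact hx.mul_right hx'
  | inv x _ hx => rw [map_inv]; exact hx.inv_right

/-- `A(Γ)` viewed inside the HNN extension of `A(Γ)` along the subgroup generated by the link
of `b`, with the vertex `b` mapped to the stable letter. -/
noncomputable def raagToHNN (Γ : SimpleGraph V) (b : V) : RAAG Γ →*
    HNNExtension (RAAG Γ) (raagSpan Γ (Γ.neighborSet b)) (raagSpan Γ (Γ.neighborSet b))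
      (MulEquiv.refl _) :=
  open scoped Classical in
  raagLift (fun v => if v = b then HNNExtension.t else HNNExtension.of (raagGen Γ v)) (by
    have key : ∀ v, Γ.Adj b v → Commute (HNNExtension.t : HNNExtension (RAAG Γ)
        (raagSpan Γ (Γ.neighborSet b)) (raagSpan Γ (Γ.neighborSet b)) (MulEquiv.refl _))
        (HNNExtension.of (raagGen Γ v)) := fun v hv =>
      HNNExtension.t_mul_of (φ := MulEquiv.refl _)
        (⟨raagGen Γ v, Subgroup.subset_closure ⟨v, hv, rfl⟩⟩ : raagSpan Γ (Γ.neighborSet b))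
    intro c d hcd
    split_ifs with hc hd hd
    · exact Commute.refl _
    · exact key d (hc ▸ hcd)
    · exact (key c (hd ▸ hcd.symm)).symm
    · exact (raagGen_commute hcd).map _)

theorem raagToHNN_raagGen_of_ne {b v : V} (h : v ≠ b) :
    raagToHNN Γ b (raagGen Γ v) = HNNExtension.of (raagGen Γ v) := by
  simp [raagToHNN, h]

open scoped Classical in
theorem raagKill_eq_self_of_raagToHNN_mem_range {b : V} {x : RAAG Γ}
    (hx : raagToHNN Γ b x ∈ (HNNExtension.of : RAAG Γ →* HNNExtension (RAAG Γ)
      (raagSpan Γ (Γ.neighborSet b)) (raagSpan Γ (Γ.neighborSet b)) (MulEquiv.refl _)).range) :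
    raagKill Γ {b} x = x := by
  let p : HNNExtension (RAAG Γ) (raagSpan Γ (Γ.neighborSet b)) (raagSpan Γ (Γ.neighborSet b))
      (MulEquiv.refl _) →* RAAG Γ :=
    HNNExtension.lift (raagKill Γ {b}) (raagGen Γ b) (by
      rintro ⟨a, ha⟩
      refine (commute_of_mem_raagSpan (f := raagKill Γ {b}) (fun v hv => ?_) ha).eq
      have hv' : Γ.Adj b v := hv
      simpa [hv'.ne'] using raagGen_commute hv')
  have hp : p.comp (raagToHNN Γ b) = MonoidHom.id _ := by
    refine raag_hom_ext fun v => ?_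
    by_cases h : v = b <;> simp [raagToHNN, h, p]
  obtain ⟨y, hy⟩ := hx
  have hxy : x = raagKill Γ {b} y := by
    have := DFunLike.congr_fun hp x
    rw [MonoidHom.comp_apply, ← hy] at this
    simpa [p] using this.symm
  rw [hxy, ← MonoidHom.comp_apply, raagKill_comp_raagKill, Set.union_self]

/-- The conjugators of two vertices in the same component of `Γ ∖ st(b)` under an endomorphism
differ by an element not involving `b`. -/
theorem raagKill_conjugator_eq {f : RAAG Γ →* RAAG Γ} {h : V → RAAG Γ}
    (hf : ∀ v, f (raagGen Γ v) = (h v)⁻¹ * raagGen Γ v * h v) {b : V} {K : Set V}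
    (hK : IsCompOf Γ (Gstar Γ b)ᶜ K) {d d' : V} (hd : d ∈ K) (hd' : d' ∈ K) :
    raagKill Γ {b} (h d * (h d')⁻¹) = h d * (h d')⁻¹ := by
  apply raagKill_eq_self_of_raagToHNN_mem_range
  obtain ⟨c, rfl⟩ := hK
  obtain ⟨x, hx, rfl⟩ := hd
  obtain ⟨x', hx', rfl⟩ := hd'
  obtain ⟨p⟩ : (Γ.induce (Gstar Γ b)ᶜ).Reachable x x' :=
    SimpleGraph.ConnectedComponent.exact (hx.trans hx'.symm)
  clear hx hx'
  induction p with
  | nil => simp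
  | @cons x y z hxy _ ih =>
    rw [show h x * (h z)⁻¹ = h x * (h y)⁻¹ * (h y * (h z)⁻¹) by group, map_mul]
    refine mul_mem ?_ ih
    have hadj : Γ.Adj (x : V) y := hxy
    have aux : ∀ v : ↥(Gstar Γ b)ᶜ, (v : V) ≠ b ∧ (v : V) ∉ Γ.neighborSet b := fun v =>
      ⟨fun e => v.2 (Or.inl e), fun e => v.2 (Or.inr e)⟩
    refine HNNExtension.mem_range_of_commute_conj (d := raagGen Γ x) (d' := raagGen Γ y)
      (conj_raagGen_notMem_raagSpan (aux x).2) (conj_raagGen_notMem_raagSpan (aux y).2) ?_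
    have := ((raagGen_commute hadj).map f).map
      ((MulAut.conj (raagToHNN Γ b (h y))).toMonoidHom.comp (raagToHNN Γ b))
    rw [hf, hf] at this
    simpa [raagToHNN_raagGen_of_ne (aux x).1, raagToHNN_raagGen_of_ne (aux y).1, mul_assoc]
      using this

theorem exists_partialConj {a : V} {K : Set V} (hK : IsCompOf Γ (Gstar Γ a)ᶜ K) :
    ∃ ψ ∈ PSA Γ, IsPartialConj Γ a K ψ := by
  classical
  have haK : a ∉ K := by
    obtain ⟨c, rfl⟩ := hK
    rintro ⟨v, -, hv⟩
    exact v.2 (Or.inl hv)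
  have hadj : ∀ c d, Γ.Adj c d → c ∈ K → d ∉ K → Commute (raagGen Γ d) (raagGen Γ a) := by
    obtain ⟨k, rfl⟩ := hK
    rintro _ d hcd ⟨c, hc, rfl⟩ hd
    by_cases hda : d ∈ Gstar Γ a
    · rcases hda with rfl | hda
      · exact Commute.refl _
      · exact (raagGen_commute hda).symm
    · refine absurd ⟨⟨d, hda⟩, ?_, rfl⟩ hd
      have : (Γ.induce (Gstar Γ a)ᶜ).Adj ⟨d, hda⟩ c := hcd.symm
      exact (SimpleGraph.ConnectedComponent.sound this.reachable).trans hc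
  have conj : ∀ y : RAAG Γ, (∀ d, Commute (raagGen Γ d) (raagGen Γ a) → Commute (raagGen Γ d) y) →
      ∀ c d, Γ.Adj c d → Commute
        (if c ∈ K then y⁻¹ * raagGen Γ c * y else raagGen Γ c)
        (if d ∈ K then y⁻¹ * raagGen Γ d * y else raagGen Γ d) := by
    have conj_comm : ∀ x y z : RAAG Γ, Commute x z → Commute z y → Commute (y⁻¹ * x * y) z :=
      fun x y z h₁ h₂ => ((h₂.symm.inv_left).mul_left h₁).mul_left h₂.symm
    intro y hy c d hcd
    split_ifs with hc hd hd
    · simpa using (raagGen_commute hcd).map (MulAut.conj y⁻¹).toMonoidHom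
    · exact conj_comm _ _ _ (raagGen_commute hcd) (hy d (hadj c d hcd hc hd))
    · exact (conj_comm _ _ _ (raagGen_commute hcd).symm (hy c (hadj d c hcd.symm hd hc))).symm
    · exact raagGen_commute hcd
  let F : RAAG Γ →* RAAG Γ := raagLift _ (conj (raagGen Γ a) fun _ h => h)
  let F' : RAAG Γ →* RAAG Γ := raagLift _ (conj (raagGen Γ a)⁻¹ fun _ h => h.inv_right)
  let ψ : MulAut (RAAG Γ) := MonoidHom.toMulEquiv F F'
    (raag_hom_ext fun v => by by_cases hv : v ∈ K <;> simp [F, F', hv, haK, mul_assoc])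
    (raag_hom_ext fun v => by by_cases hv : v ∈ K <;> simp [F, F', hv, haK, mul_assoc])
  have hψ : ∀ v, ψ (raagGen Γ v) = if v ∈ K then (raagGen Γ a)⁻¹ * raagGen Γ v * raagGen Γ a
      else raagGen Γ v := fun v => (raagLift_raagGen _ _ v : F (raagGen Γ v) = _)
  refine ⟨ψ, fun v => ?_, hK, fun v hv => by simp [hψ, hv], fun v hv => by simp [hψ, hv]⟩
  rw [hψ]
  split_ifs
  · exact isConj_iff.2 ⟨(raagGen Γ a)⁻¹, by simp⟩
  · exact IsConj.refl _

end RAAG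

section PSet

open Monoid Monoid.CoprodI

/-- The domains of partial conjugations in `J false` and `J true` with mutually separated
letters, as in an admissible partition of a p-set. -/
structure PSetData {V : Type} (Γ : SimpleGraph V) (J : Bool → Type) where
  letter : (Σ b, J b) → V
  dom : (Σ b, J b) → Set V
  letter_injective : Function.Injective letter
  isCompOf : ∀ s, IsCompOf Γ (Gstar Γ (letter s))ᶜ (dom s)
  letter_mem_dom : ∀ s s', s.1 ≠ s'.1 → letter s' ∈ dom s

/-- The free product of the free abelian groups with bases `J false` and `J true`. -/
abbrev FreeAbCoprod (J : Bool → Type) : Type :=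
  CoprodI fun b => Multiplicative (FreeAbelianGroup (J b))

/-- The inclusion of a factor. -/
abbrev FreeAbCoprod.incl {J : Bool → Type} (b : Bool) :
    Multiplicative (FreeAbelianGroup (J b)) →* FreeAbCoprod J :=
  CoprodI.of (M := fun b => Multiplicative (FreeAbelianGroup (J b)))

/-- The standard generators of the free product of two free abelian groups. -/
def FreeAbCoprod.gen {J : Bool → Type} (s : Σ b, J b) : FreeAbCoprod J :=
  incl s.1 (Multiplicative.ofAdd (FreeAbelianGroup.of s.2))

open FreeAbCoprod

theorem FreeAbCoprod.gen_commute {J : Bool → Type} {s s' : Σ b, J b} (h : s.1 = s'.1) :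
    Commute (gen s) (gen s') := by
  obtain ⟨b, i⟩ := s
  obtain ⟨b', i'⟩ := s'
  obtain rfl : b = b' := h
  exact (Commute.all _ _).map (incl b)

theorem FreeAbCoprod.of_commute_gen {J : Bool → Type} (s : Σ b, J b)
    (x : Multiplicative (FreeAbelianGroup (J s.1))) :
    Commute (incl s.1 x) (gen s) :=
  (Commute.all _ _).map (incl s.1)

theorem FreeAbCoprod.eq_top_of_gen_mem {J : Bool → Type} {H : Subgroup (FreeAbCoprod J)}
    (hH : ∀ s, gen s ∈ H) : H = ⊤ := by
  refine (Subgroup.eq_top_iff' H).2 fun x => ?_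
  induction x using CoprodI.induction_on with
  | one => exact one_mem _
  | mul x y hx hy => exact mul_mem hx hy
  | of b m =>
    obtain ⟨m, rfl⟩ := Multiplicative.ofAdd.surjective m
    induction m using FreeAbelianGroup.induction_on with
    | zero => simp
    | of i => exact hH ⟨b, i⟩
    | neg i hi => rw [ofAdd_neg, map_inv]; exact inv_mem hi
    | add x y hx hy => rw [ofAdd_add, map_mul]; exact mul_mem hx hy

theorem IsCompOf.eq_of_mem {V : Type} {Γ : SimpleGraph V} {S K K' : Set V}
    (hK : IsCompOf Γ S K) (hK' : IsCompOf Γ S K') {v : V} (hv : v ∈ K) (hv' : v ∈ K') :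
    K = K' := by
  obtain ⟨c, rfl⟩ := hK
  obtain ⟨c', rfl⟩ := hK'
  obtain ⟨x, hx, rfl⟩ := hv
  obtain ⟨x', hx', h⟩ := hv'
  obtain rfl := Subtype.ext h
  rw [show c = c' from hx.symm.trans hx']

namespace PSetData

variable {V : Type} {Γ : SimpleGraph V} {J : Bool → Type} (D : PSetData Γ J)

theorem index_eq_of_adj {s s' : Σ b, J b} (h : Γ.Adj (D.letter s) (D.letter s')) :
    s.1 = s'.1 := by
  by_contra hne
  obtain ⟨c, hc⟩ := D.isCompOf s
  have := D.letter_mem_dom s s' hne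
  rw [hc] at this
  obtain ⟨x, -, hx⟩ := this
  exact x.2 (Or.inr (hx ▸ h))

/-- The images of the vertices under `PSetData.rep`. -/
noncomputable def vertexImage : V → FreeAbCoprod J :=
  Function.extend D.letter (fun s => (gen s)⁻¹) 1

theorem vertexImage_letter (s : Σ b, J b) : D.vertexImage (D.letter s) = (gen s)⁻¹ :=
  D.letter_injective.extend_apply _ _ _

theorem vertexImage_of_notMem {v : V} (h : v ∉ Set.range D.letter) : D.vertexImage v = 1 :=
  Function.extend_apply' _ _ _ h

theorem commute_vertexImage {v w : V}
    (h : ∀ s s', D.letter s = v → D.letter s' = w → s.1 = s'.1) :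
    Commute (D.vertexImage v) (D.vertexImage w) := by
  by_cases hv : v ∈ Set.range D.letter
  · by_cases hw : w ∈ Set.range D.letter
    · obtain ⟨s, rfl⟩ := hv
      obtain ⟨s', rfl⟩ := hw
      rw [vertexImage_letter, vertexImage_letter]
      exact (gen_commute (h s s' rfl rfl)).inv_inv
    · simp [D.vertexImage_of_notMem hw]
  · simp [D.vertexImage_of_notMem hv]

/-- The homomorphism from `A(Γ)` to the free product of free abelian groups that sends the acting
letters to inverses of the generators and kills the other vertices. -/
noncomputable def rep : RAAG Γ →* FreeAbCoprod J :=
  raagLift D.vertexImage fun _ _ hab =>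
    D.commute_vertexImage fun _ _ hs hs' => D.index_eq_of_adj (hs ▸ hs' ▸ hab)

@[simp]
theorem rep_raagGen (v : V) : D.rep (raagGen Γ v) = D.vertexImage v :=
  raagLift_raagGen _ _ _

theorem rep_surjective : Function.Surjective D.rep := by
  rw [← MonoidHom.range_eq_top]
  refine eq_top_of_gen_mem fun s => ⟨(raagGen Γ (D.letter s))⁻¹, ?_⟩
  simp [vertexImage_letter]

/-- The acting letters on the side `b`. -/
def letters (b : Bool) : Set V := Set.range fun j : J b => D.letter ⟨b, j⟩

theorem rep_mem_range_of_raagKill_eq {b : Bool} {x : RAAG Γ}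
    (hx : raagKill Γ (D.letters !b) x = x) :
    D.rep x ∈ (incl b : _ →* FreeAbCoprod J).range := by
  rw [← hx]
  have h : (⊤ : Subgroup (RAAG Γ)) ≤ ((incl b : _ →* FreeAbCoprod J).range).comap
      (D.rep.comp (raagKill Γ (D.letters !b))) := by
    rw [← closure_range_raagGen, Subgroup.closure_le]
    rintro _ ⟨v, rfl⟩
    rw [SetLike.mem_coe, Subgroup.mem_comap, MonoidHom.comp_apply, raagKill_raagGen]
    by_cases hv : v ∈ D.letters !b
    · rw [if_pos hv, map_one]
      exact one_mem _
    · by_cases hv' : v ∈ Set.range D.letter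
      · obtain ⟨⟨b', i⟩, rfl⟩ := hv'
        obtain rfl : b' = b := by
          by_contra hne
          obtain rfl : b' = !b := Bool.eq_not_of_ne hne
          exact hv ⟨i, rfl⟩
        rw [if_neg hv, rep_raagGen, vertexImage_letter]
        exact inv_mem ⟨_, rfl⟩
      · rw [if_neg hv, rep_raagGen, D.vertexImage_of_notMem hv']
        exact one_mem _
  exact h (Subgroup.mem_top x)

theorem rep_conjugator_mem_range [Finite V] {f : RAAG Γ →* RAAG Γ} {h : V → RAAG Γ}
    (hf : ∀ v, f (raagGen Γ v) = (h v)⁻¹ * raagGen Γ v * h v) {b : Bool} (i i' : J b) :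
    D.rep (h (D.letter ⟨b, i⟩)) * (D.rep (h (D.letter ⟨b, i'⟩)))⁻¹ ∈
      (incl b : _ →* FreeAbCoprod J).range := by
  rw [← map_inv, ← map_mul]
  refine D.rep_mem_range_of_raagKill_eq
    (raagKill_eq_self_of_forall_mem (Set.toFinite _) ?_)
  rintro _ ⟨j, rfl⟩
  exact raagKill_conjugator_eq hf (D.isCompOf _) (D.letter_mem_dom ⟨!b, j⟩ ⟨b, i⟩ (by simp))
    (D.letter_mem_dom ⟨!b, j⟩ ⟨b, i'⟩ (by simp))

theorem rep_comp_eq_conj {f : RAAG Γ →* RAAG Γ} {h : V → RAAG Γ}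
    (hf : ∀ v, f (raagGen Γ v) = (h v)⁻¹ * raagGen Γ v * h v) {F : FreeAbCoprod J →* FreeAbCoprod J}
    {y : FreeAbCoprod J}
    (hF : ∀ s, (D.rep (h (D.letter s)))⁻¹ * gen s * D.rep (h (D.letter s)) =
      y * F (gen s) * y⁻¹) (x : RAAG Γ) :
    D.rep (f x) = y * F (D.rep x) * y⁻¹ := by
  suffices D.rep.comp f = ((MulAut.conj y).toMonoidHom.comp F).comp D.rep from
    DFunLike.congr_fun this x
  refine raag_hom_ext fun v => ?_
  by_cases hv : v ∈ Set.range D.letter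
  · obtain ⟨s, rfl⟩ := hv
    have := congrArg (·⁻¹) (hF s)
    simpa [hf, vertexImage_letter, mul_assoc] using this
  · simp [hf, D.vertexImage_of_notMem hv]

/-- A pure symmetric automorphism induces an inner automorphism of the free product. -/
theorem exists_rep_eq_conj [Finite V] [∀ b, Nonempty (J b)] {ψ : MulAut (RAAG Γ)}
    (hψ : ψ ∈ PSA Γ) : ∃ g : FreeAbCoprod J, ∀ x, D.rep (ψ x) = g * D.rep x * g⁻¹ := by
  have hconj : ∀ v, ∃ h : RAAG Γ, ψ (raagGen Γ v) = h⁻¹ * raagGen Γ v * h := fun v => by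
    obtain ⟨c, hc⟩ := isConj_iff.1 (hψ v)
    exact ⟨c⁻¹, by simp [hc]⟩
  choose h hh using hconj
  have hf : ∀ v, ψ.toMonoidHom (raagGen Γ v) = (h v)⁻¹ * raagGen Γ v * h v := hh
  let j : ∀ b, J b := fun b => Classical.arbitrary _
  let X : Bool → FreeAbCoprod J := fun b => D.rep (h (D.letter ⟨b, j b⟩))
  have hX : ∀ s, (D.rep (h (D.letter s)))⁻¹ * gen s * D.rep (h (D.letter s)) =
      (X s.1)⁻¹ * gen s * X s.1 := by
    rintro ⟨b, i⟩
    obtain ⟨e, he⟩ := D.rep_conjugator_mem_range hf i (j b)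
    rw [show D.rep (h (D.letter ⟨b, i⟩)) = incl b e * X b from
      (eq_mul_inv_iff_mul_eq.1 he).symm]
    have := (of_commute_gen ⟨b, i⟩ e).inv_left.eq
    calc _ = (X b)⁻¹ * ((incl b e)⁻¹ * gen ⟨b, i⟩) * incl b e * X b := by group
      _ = _ := by rw [this]; group
  obtain ⟨p, ω, q, hw, hω⟩ := exists_doubleCoset_decomposition true false (X true * (X false)⁻¹)
  have hX' : X false = (incl false q)⁻¹ * ω⁻¹ * (incl true p)⁻¹ * X true := by
    have : X false = (incl true p * ω * incl false q)⁻¹ * X true := by rw [← hw]; group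
    rw [this]; group
  have hp : ∀ i : J true, incl true p * gen ⟨true, i⟩ * (incl true p)⁻¹ =
      gen ⟨true, i⟩ := fun i => mul_inv_eq_of_eq_mul (of_commute_gen ⟨true, i⟩ p).eq
  have hq : ∀ i : J false, incl false q * gen ⟨false, i⟩ * (incl false q)⁻¹ =
      gen ⟨false, i⟩ := fun i => mul_inv_eq_of_eq_mul (of_commute_gen ⟨false, i⟩ q).eq
  let F : FreeAbCoprod J →* FreeAbCoprod J := CoprodI.lift fun b =>
    ((MulAut.conj (bif b then 1 else ω)).toMonoidHom.comp (incl b))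
  have hFt : ∀ x : Multiplicative (FreeAbelianGroup (J true)),
      F (incl true x) = incl true x := fun x => by simp [F]
  have hFf : ∀ x : Multiplicative (FreeAbelianGroup (J false)),
      F (incl false x) = ω * incl false x * ω⁻¹ := fun x => by simp [F]
  have key := D.rep_comp_eq_conj (y := (X true)⁻¹ * incl true p) (F := F) hf (by
    rintro ⟨b, i⟩
    rw [hX]
    cases b with
    | true =>
      rw [gen, hFt, ← gen]
      calc _ = (X true)⁻¹ * gen ⟨true, i⟩ * X true := rfl
        _ = (X true)⁻¹ * (incl true p * gen ⟨true, i⟩ * (incl true p)⁻¹) * X true := by rw [hp]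
        _ = _ := by group
    | false =>
      rw [gen, hFf, ← gen]
      calc _ = (X false)⁻¹ * gen ⟨false, i⟩ * X false := rfl
        _ = (X true)⁻¹ * incl true p * ω * (incl false q * gen ⟨false, i⟩ * (incl false q)⁻¹) *
            ω⁻¹ * (incl true p)⁻¹ * X true := by rw [hX']; group
        _ = _ := by rw [hq]; group)
  rcases hω with rfl | ⟨a, b, w, ha, hb, rfl⟩
  · refine ⟨(X true)⁻¹ * incl true p, fun x => ?_⟩
    have hF1 : F = MonoidHom.id _ := CoprodI.ext_hom _ _ fun b => by
      cases b <;> refine MonoidHom.ext fun x => ?_ <;> simp [F]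
    rw [hF1] at key
    exact key x
  · exfalso
    obtain rfl : a = false := by simpa using ha
    obtain rfl : b = true := by simpa using hb
    refine not_surjective_of_conj w F hFt hFf fun z => ?_
    obtain ⟨x, hx⟩ := D.rep_surjective
      ((X true)⁻¹ * incl true p * z * ((X true)⁻¹ * incl true p)⁻¹)
    obtain ⟨x', rfl⟩ := ψ.surjective x
    have h2 := (key x').symm.trans hx
    exact ⟨D.rep x', mul_left_cancel (mul_right_cancel h2)⟩

theorem conj_unique [∀ b, Nonempty (J b)] {g g' : FreeAbCoprod J}
    (h : ∀ x, g * D.rep x * g⁻¹ = g' * D.rep x * g'⁻¹) : g = g' := by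
  have := eq_one_of_forall_commute (M := fun b => Multiplicative (FreeAbelianGroup (J b)))
    Bool.false_ne_true (z := g'⁻¹ * g) fun y => by
      obtain ⟨x, rfl⟩ := D.rep_surjective y
      have := h x
      rw [mul_inv_eq_iff_eq_mul] at this
      calc g'⁻¹ * g * D.rep x = g'⁻¹ * (g * D.rep x) := by group
        _ = _ := by rw [this]; group
  exact (inv_mul_eq_one.1 this).symm

/-- The homomorphism from `PΣ(A)` recording the induced inner automorphism. -/
noncomputable def psaHom [Finite V] [∀ b, Nonempty (J b)] : PSA Γ →* FreeAbCoprod J :=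
  MonoidHom.mk' (fun ψ => (D.exists_rep_eq_conj ψ.2).choose) fun ψ ψ' => D.conj_unique fun x => by
    rw [← (D.exists_rep_eq_conj (ψ * ψ').2).choose_spec x]
    have h₁ := (D.exists_rep_eq_conj ψ.2).choose_spec ((ψ' : MulAut (RAAG Γ)) x)
    have h₂ := (D.exists_rep_eq_conj ψ'.2).choose_spec x
    rw [Subgroup.coe_mul, MulAut.mul_apply, h₁, h₂]
    group

theorem psaHom_eq_of_forall_raagGen [Finite V] [∀ b, Nonempty (J b)] {ψ : MulAut (RAAG Γ)}
    (hψ : ψ ∈ PSA Γ) {g : FreeAbCoprod J}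
    (h : ∀ v, D.rep (ψ (raagGen Γ v)) = g * D.vertexImage v * g⁻¹) :
    D.psaHom ⟨ψ, hψ⟩ = g := by
  refine D.conj_unique fun x => ((D.exists_rep_eq_conj hψ).choose_spec x).symm.trans ?_
  suffices D.rep.comp ψ.toMonoidHom = (MulAut.conj g).toMonoidHom.comp D.rep from
    DFunLike.congr_fun this x
  exact raag_hom_ext fun v => by simpa using h v

theorem psaHom_partialConj [Finite V] [∀ b, Nonempty (J b)] {ψ : MulAut (RAAG Γ)}
    (hψ : ψ ∈ PSA Γ) {s : Σ b, J b} (h : IsPartialConj Γ (D.letter s) (D.dom s) ψ) :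
    D.psaHom ⟨ψ, hψ⟩ = gen s := by
  refine D.psaHom_eq_of_forall_raagGen hψ fun v => ?_
  by_cases hv : v ∈ D.dom s
  · simp [h.2.1 v hv, vertexImage_letter]
  · have := D.commute_vertexImage (v := D.letter s) (w := v) fun t s' ht hs' => by
      obtain rfl := D.letter_injective ht
      by_contra hne
      exact hv (hs' ▸ D.letter_mem_dom t s' hne)
    rw [vertexImage_letter] at this
    rw [h.2.2 v hv, rep_raagGen]
    exact (mul_inv_eq_of_eq_mul (Commute.inv_left_iff.1 this).eq).symm

theorem psaHom_surjective [Finite V] [∀ b, Nonempty (J b)] :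
    Function.Surjective D.psaHom := by
  rw [← MonoidHom.range_eq_top]
  refine eq_top_of_gen_mem fun s => ?_
  obtain ⟨ψ, hψ, h⟩ := exists_partialConj (D.isCompOf s)
  exact ⟨⟨ψ, hψ⟩, D.psaHom_partialConj hψ h⟩

theorem psaHom_partialConj_eq_one [Finite V] [∀ b, Nonempty (J b)] {ψ : MulAut (RAAG Γ)}
    (hψ : ψ ∈ PSA Γ) {c : V} {M : Set V} (h : IsPartialConj Γ c M ψ)
    (hcM : ∀ s, (c, M) ≠ (D.letter s, D.dom s)) :
    D.psaHom ⟨ψ, hψ⟩ = 1 := by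
  refine D.psaHom_eq_of_forall_raagGen hψ fun v => ?_
  by_cases hv : v ∈ M
  · have := D.commute_vertexImage (v := c) (w := v) fun s s' hs hs' => by
      subst hs hs'
      by_contra hne
      exact hcM s (Prod.ext rfl (h.1.eq_of_mem (D.isCompOf s) hv (D.letter_mem_dom s s' hne)))
    simp [h.2.1 v hv, this.inv_left.eq]
  · simp [h.2.2 v hv]

end PSetData

end PSet

/-- The `Bool`-indexed family with values `S` at `false` and `T` at `true`. -/
abbrev boolFamily (S T : Type) (b : Bool) : Type := bif b then T else S

section

open Monoid FreeAbCoprod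

/-- The free product of a `Bool`-indexed family as a binary free product. -/
def FreeAbCoprod.equivCoprodOfBool (J : Bool → Type) : FreeAbCoprod J ≃*
    Coprod (Multiplicative (FreeAbelianGroup (J false)))
      (Multiplicative (FreeAbelianGroup (J true))) :=
  MonoidHom.toMulEquiv
    (CoprodI.lift fun b => match b with
      | false => Coprod.inl
      | true => Coprod.inr)
    (Coprod.lift (incl false) (incl true))
    (CoprodI.ext_hom _ _ fun b => by
      cases b <;> refine MonoidHom.ext fun x => ?_ <;> simp [incl])
    (by apply Coprod.hom_ext <;> refine MonoidHom.ext fun x => ?_ <;> simp [incl])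

/-- The free product of the free abelian groups on `S` and `T` as a binary free product. -/
def FreeAbCoprod.equivCoprod (S T : Type) : FreeAbCoprod (boolFamily S T) ≃*
    Coprod (Multiplicative (FreeAbelianGroup S)) (Multiplicative (FreeAbelianGroup T)) :=
  equivCoprodOfBool (boolFamily S T)

variable {S T : Type}

theorem FreeAbCoprod.equivCoprod_gen_false (i : S) :
    equivCoprod S T (gen (J := boolFamily S T) ⟨false, i⟩) =
      Coprod.inl (Multiplicative.ofAdd (FreeAbelianGroup.of i)) :=
  CoprodI.lift_of _ _

theorem FreeAbCoprod.equivCoprod_gen_true (i : T) :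
    equivCoprod S T (gen (J := boolFamily S T) ⟨true, i⟩) =
      Coprod.inr (Multiplicative.ofAdd (FreeAbelianGroup.of i)) :=
  CoprodI.lift_of _ _

end

/-- from Proposition 4.1. Given a p-set `Q` with admissible partition
`{Q₁, Q₂}`, `Q₁ = {π_{a₁,K₁}, …, π_{a_m,K_m}}`, `Q₂ = {π_{b₁,L₁}, …, π_{b_n,L_n}}`, there is
a (necessarily surjective) homomorphism `φ : PΣ(A) → G₁ ∗ G₂` onto the free product of the
free abelian groups `G₁ = ⟨u₁, …, u_m⟩` and `G₂ = ⟨v₁, …, v_n⟩`, with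
`π_{a_i,K_i} ↦ u_i`, `π_{b_j,L_j} ↦ v_j`, and all other partial conjugations mapping
to the identity. -/
theorem p_set_gives_free_product_quotient {V : Type} [Fintype V] (Γ : SimpleGraph V)
    (hZ : (Zset Γ).Nonempty) (m n : ℕ)
    (pc₁ : Fin m → V × Set V) (pc₂ : Fin n → V × Set V)
    (hinj₁ : Function.Injective pc₁) (hinj₂ : Function.Injective pc₂)
    (hQ : IsPSet Γ (Set.range pc₁ ∪ Set.range pc₂))
    (hpart : IsAdmissiblePartition (Set.range pc₁) (Set.range pc₂)) :
    ∃ φ : ↥(PSA Γ) →*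
        Monoid.Coprod (Multiplicative (FreeAbelianGroup (Fin m)))
          (Multiplicative (FreeAbelianGroup (Fin n))),
      Function.Surjective φ ∧
      (∀ i : Fin m, ∃ (ψ : MulAut (RAAG Γ)) (h : ψ ∈ PSA Γ),
        IsPartialConj Γ (pc₁ i).1 (pc₁ i).2 ψ ∧
        φ ⟨ψ, h⟩ = Monoid.Coprod.inl (Multiplicative.ofAdd (FreeAbelianGroup.of i))) ∧
      (∀ j : Fin n, ∃ (ψ : MulAut (RAAG Γ)) (h : ψ ∈ PSA Γ),
        IsPartialConj Γ (pc₂ j).1 (pc₂ j).2 ψ ∧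
        φ ⟨ψ, h⟩ = Monoid.Coprod.inr (Multiplicative.ofAdd (FreeAbelianGroup.of j))) ∧
      (∀ (c : V) (M : Set V) (ψ : MulAut (RAAG Γ)) (h : ψ ∈ PSA Γ),
        IsPartialConj Γ c M ψ → (c, M) ∉ Set.range pc₁ ∪ Set.range pc₂ →
        φ ⟨ψ, h⟩ = 1) := by
  let pcs : ∀ b, boolFamily (Fin m) (Fin n) b → V × Set V := fun b => match b with
    | false => pc₁
    | true => pc₂
  obtain ⟨hPC, hletter, -⟩ := hQ
  obtain ⟨hdisj, ⟨_, i₁, -⟩, ⟨_, i₂, -⟩, hsep⟩ := hpart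
  have hJ : ∀ b, Nonempty (boolFamily (Fin m) (Fin n) b) := fun b => match b with
    | false => ⟨i₁⟩
    | true => ⟨i₂⟩
  have hmem : ∀ b i, pcs b i ∈ Set.range pc₁ ∪ Set.range pc₂ := fun b i => match b, i with
    | false, i => .inl ⟨i, rfl⟩
    | true, i => .inr ⟨i, rfl⟩
  let D : PSetData Γ (boolFamily (Fin m) (Fin n)) :=
    { letter := fun s => (pcs s.1 s.2).1
      dom := fun s => (pcs s.1 s.2).2
      letter_injective := by
        rintro ⟨b, i⟩ ⟨b', i'⟩ h
        have heq : pcs b i = pcs b' i' := hletter _ ⟨hmem b i, h⟩ ⟨hmem b' i', rfl⟩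
        cases b <;> cases b'
        · rw [hinj₁ heq]
        · exact (Set.disjoint_left.1 hdisj ⟨i, rfl⟩ ⟨i', heq.symm⟩).elim
        · exact (Set.disjoint_left.1 hdisj ⟨i', rfl⟩ ⟨i, heq⟩).elim
        · rw [hinj₂ heq]
      isCompOf := fun s => hPC (hmem s.1 s.2)
      letter_mem_dom := by
        rintro ⟨b, i⟩ ⟨b', i'⟩ h
        cases b <;> cases b'
        · exact (h rfl).elim
        · exact (hsep _ ⟨i, rfl⟩ _ ⟨i', rfl⟩).2
        · exact (hsep _ ⟨i', rfl⟩ _ ⟨i, rfl⟩).1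
        · exact (h rfl).elim }
  have hgen : ∀ s : Σ b, boolFamily (Fin m) (Fin n) b, ∃ (ψ : MulAut (RAAG Γ)) (h : ψ ∈ PSA Γ),
      IsPartialConj Γ (pcs s.1 s.2).1 (pcs s.1 s.2).2 ψ ∧
      FreeAbCoprod.equivCoprod (Fin m) (Fin n) (D.psaHom ⟨ψ, h⟩) =
        FreeAbCoprod.equivCoprod (Fin m) (Fin n) (FreeAbCoprod.gen s) := fun s => by
    obtain ⟨ψ, hψ, h⟩ := exists_partialConj (D.isCompOf s)
    exact ⟨ψ, hψ, h, congrArg _ (D.psaHom_partialConj hψ h)⟩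
  refine ⟨(FreeAbCoprod.equivCoprod (Fin m) (Fin n)).toMonoidHom.comp D.psaHom,
    (FreeAbCoprod.equivCoprod (Fin m) (Fin n)).surjective.comp D.psaHom_surjective,
    fun i => ?_, fun j => ?_, fun c M ψ hψ h hcM => ?_⟩
  · obtain ⟨ψ, hψ, h, h'⟩ := hgen ⟨false, i⟩
    exact ⟨ψ, hψ, h, h'.trans (FreeAbCoprod.equivCoprod_gen_false i)⟩
  · obtain ⟨ψ, hψ, h, h'⟩ := hgen ⟨true, j⟩
    exact ⟨ψ, hψ, h, h'.trans (FreeAbCoprod.equivCoprod_gen_true j)⟩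
  · have := D.psaHom_partialConj_eq_one hψ h fun s hs => hcM (hs ▸ hmem s.1 s.2)
    simp [this]
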